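/- arXiv:2304.12528 — 3 statements merged into one kernel-verified Lean document; each statement's English description precedes it below -/
import Mathlib

section
/- Let σ > 0, n a positive natural number, λ > 1, and μ, ν ∈ ℝⁿ. Let P = ⊗_{i=1}^{n} N(μᵢ, σ²) and Q = ⊗_{i=1}^{n} N(νᵢ, σ²) be the product Gaussian measures on ℝⁿ (the isotropic Gaussians N(μ, σ²I) and N(ν, σ²I)). Then ∫ (dP/dQ)^{λ−1} dP = exp( (λ−1)·λ·‖μ−ν‖₂² / (2σ²) ); equivalently, D_λ(P‖Q) = λ‖μ−ν‖₂²/(2σ²). -/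
open Real ProbabilityTheory MeasureTheory

/-- The product of the measures with densities `f i` has the product density. -/
theorem pi_withDensity_ofReal {ι : Type*} [Fintype ι] {X : ι → Type*}
    [∀ i, MeasurableSpace (X i)] (m : ∀ i, Measure (X i)) [∀ i, SigmaFinite (m i)]
    {f : ∀ i, X i → ℝ} (hf : ∀ i, Integrable (f i) (m i)) (hf0 : ∀ i x, 0 ≤ f i x) :
    (Measure.pi fun i => (m i).withDensity fun x => ENNReal.ofReal (f i x)) =
      (Measure.pi m).withDensity fun x => ENNReal.ofReal (∏ i, f i (x i)) := by
  refine Measure.pi_eq fun s hs => ?_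
  rw [withDensity_apply _ (MeasurableSet.univ_pi hs), Measure.restrict_pi_pi,
    ← ofReal_integral_eq_lintegral_ofReal
      (Integrable.fintype_prod_dep fun i => (hf i).restrict)
      (ae_of_all _ fun x => Finset.prod_nonneg fun i _ => hf0 i (x i)),
    integral_fintype_prod_eq_prod, ENNReal.ofReal_prod_of_nonneg
      fun i _ => integral_nonneg (hf0 i)]
  refine Finset.prod_congr rfl fun i _ => ?_
  rw [withDensity_apply _ (hs i), ofReal_integral_eq_lintegral_ofReal (hf i).restrict
    (ae_of_all _ (hf0 i))]

/-- The integral of the exponential of an affine function against a Gaussian measure. -/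
theorem integral_exp_mul_add_gaussianReal (a : ℝ) (v : NNReal) (t c : ℝ) :
    ∫ x, rexp (t * x + c) ∂(gaussianReal a v) = rexp (a * t + v * t ^ 2 / 2 + c) := by
  have h := congrFun (mgf_id_gaussianReal (μ := a) (v := v)) t
  simp only [mgf, id] at h
  simp_rw [Real.exp_add _ c]
  rw [integral_mul_const, h]

/-- The density of one Gaussian measure with respect to another of the same variance. -/
theorem gaussianReal_eq_withDensity (a b : ℝ) {v : NNReal} (hv : v ≠ 0) :
    gaussianReal a v = (gaussianReal b v).withDensity fun x =>
      ENNReal.ofReal (rexp ((a - b) / v * x + (b ^ 2 - a ^ 2) / (2 * v))) := by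
  rw [gaussianReal_of_var_ne_zero a hv, gaussianReal_of_var_ne_zero b hv,
    ← withDensity_mul _ (measurable_gaussianPDF b v) (by fun_prop)]
  congr 1
  funext x
  have hv' : (v : ℝ) ≠ 0 := by exact_mod_cast hv
  rw [Pi.mul_apply, gaussianPDF, gaussianPDF, ← ENNReal.ofReal_mul (gaussianPDFReal_nonneg b v x),
    gaussianPDFReal, gaussianPDFReal, mul_assoc _ (rexp _), ← Real.exp_add]
  congr 3
  field_simp
  ring

/-- The Rényi integral between two isotropic Gaussians of variance `v`. -/
theorem renyi_integral_pi_gaussianReal {n : ℕ} (l : ℝ) (μ ν : EuclideanSpace ℝ (Fin n))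
    {v : NNReal} (hv : v ≠ 0) :
    ∫ x, ((Measure.pi fun i : Fin n => gaussianReal (μ i) v).rnDeriv
          (Measure.pi fun i : Fin n => gaussianReal (ν i) v) x).toReal ^ (l - 1)
        ∂(Measure.pi fun i : Fin n => gaussianReal (μ i) v) =
      rexp ((l - 1) * l * ‖μ - ν‖ ^ 2 / (2 * v)) := by
  have hv' : (v : ℝ) ≠ 0 := by exact_mod_cast hv
  set P := Measure.pi fun i : Fin n => gaussianReal (μ i) v with hP
  set Q := Measure.pi fun i : Fin n => gaussianReal (ν i) v with hQ
  set f : Fin n → ℝ → ℝ := fun i x =>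
    rexp ((μ i - ν i) / v * x + ((ν i) ^ 2 - (μ i) ^ 2) / (2 * v)) with hf
  have hPQ : P = Q.withDensity fun x => ENNReal.ofReal (∏ i, f i (x i)) := by
    rw [hQ, ← pi_withDensity_ofReal (f := f) _ (fun i => ?_) fun i x => (Real.exp_pos _).le]
    · rw [hP]
      congr 1
      funext i
      exact gaussianReal_eq_withDensity (μ i) (ν i) hv
    · simp only [hf, Real.exp_add]
      exact (integrable_exp_mul_gaussianReal _).mul_const _
  have hac : P ≪ Q := hPQ ▸ withDensity_absolutelyContinuous Q _
  have hder : P.rnDeriv Q =ᵐ[P] fun x => ENNReal.ofReal (∏ i, f i (x i)) := by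
    refine hac.ae_le ?_
    rw [hPQ]
    exact Measure.rnDeriv_withDensity Q (by fun_prop)
  have hpow : ∀ᵐ x ∂P, (P.rnDeriv Q x).toReal ^ (l - 1) =
      ∏ i, rexp ((l - 1) * (μ i - ν i) / v * x i +
        (l - 1) * ((ν i) ^ 2 - (μ i) ^ 2) / (2 * v)) := by
    filter_upwards [hder] with x hx
    have hpos : ∀ i ∈ Finset.univ, 0 ≤ f i (x i) := fun i _ => (Real.exp_pos _).le
    rw [hx, ENNReal.toReal_ofReal (Finset.prod_nonneg hpos), ← Real.finsetProd_rpow _ _ hpos]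
    refine Finset.prod_congr rfl fun i _ => ?_
    rw [hf, ← Real.exp_mul]
    congr 1
    ring
  rw [integral_congr_ae hpow, hP, integral_fintype_prod_eq_prod (fun i x =>
    rexp ((l - 1) * (μ i - ν i) / v * x + (l - 1) * ((ν i) ^ 2 - (μ i) ^ 2) / (2 * v)))]
  simp_rw [integral_exp_mul_add_gaussianReal]
  rw [← Real.exp_sum, EuclideanSpace.real_norm_sq_eq, Finset.mul_sum, Finset.sum_div]
  congr 1
  refine Finset.sum_congr rfl fun i _ => ?_
  rw [PiLp.sub_apply]
  field_simp
  ring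

/-- Rényi integral between two isotropic Gaussians `N(μ, σ²I)` and `N(ν, σ²I)` on `ℝⁿ`:
`∫ (dP/dQ)^(λ-1) dP = exp ((λ-1) * λ * ‖μ-ν‖² / (2σ²))`. -/
theorem renyi_integral_product_gaussian_eq (σ : ℝ) (hσ : 0 < σ) (n : ℕ) (hn : 0 < n)
    (l : ℝ) (hl : 1 < l) (μ ν : EuclideanSpace ℝ (Fin n)) :
    ∫ x, ((Measure.pi fun i : Fin n => gaussianReal (μ i) ⟨σ ^ 2, sq_nonneg σ⟩).rnDeriv
          (Measure.pi fun i : Fin n => gaussianReal (ν i) ⟨σ ^ 2, sq_nonneg σ⟩) x).toReal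
          ^ (l - 1)
        ∂(Measure.pi fun i : Fin n => gaussianReal (μ i) ⟨σ ^ 2, sq_nonneg σ⟩) =
      Real.exp ((l - 1) * l * ‖μ - ν‖ ^ 2 / (2 * σ ^ 2)) := by
  have hv : (⟨σ ^ 2, sq_nonneg σ⟩ : NNReal) ≠ 0 := fun h =>
    pow_ne_zero 2 hσ.ne' (congrArg NNReal.toReal h)
  exact renyi_integral_pi_gaussianReal l μ ν hv
end

section
/- Gaussian mechanism (Rényi DP guarantee): let σ > 0, n a positive natural number, λ > 1, S ≥ 0, and μ, ν ∈ ℝⁿ with ‖μ−ν‖₂ ≤ S. Then the isotropic Gaussian measures P = ⊗_{i=1}^{n} N(μᵢ, σ²) and Q = ⊗_{i=1}^{n} N(νᵢ, σ²) on ℝⁿ satisfy ∫ (dP/dQ)^λ dQ ≤ exp( (λ−1)·λ·S² / (2σ²) ), i.e., D_λ(P‖Q) ≤ λS²/(2σ²), so the mechanism A(x) = f(x) + N(0, σ²I) with ℓ₂-sensitivity S of f is (λ, λS²/(2σ²))-RDP. -/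
open Real ProbabilityTheory MeasureTheory

open scoped NNReal ENNReal

/-- The product of probability measures with densities has the product of the densities as its
density with respect to the product of the reference measures. -/
theorem pi_withDensity {ι : Type*} [Fintype ι] {α : ι → Type*} [∀ i, MeasurableSpace (α i)]
    (μ : ∀ i, Measure (α i)) [∀ i, IsProbabilityMeasure (μ i)] {f : ∀ i, α i → ℝ≥0∞}
    (hf : ∀ i, Measurable (f i)) [∀ i, SigmaFinite ((μ i).withDensity (f i))] :
    Measure.pi (fun i ↦ (μ i).withDensity (f i)) =
      (Measure.pi μ).withDensity fun x ↦ ∏ i, f i (x i) := by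
  refine Measure.pi_eq fun s hs ↦ ?_
  have hmeas (i : ι) : Measurable ((s i).indicator (f i)) := (hf i).indicator (hs i)
  have hind : (Set.univ.pi s).indicator (fun x ↦ ∏ i, f i (x i)) =
      fun x ↦ ∏ i, (s i).indicator (f i) (x i) := by
    ext x
    by_cases hx : x ∈ Set.univ.pi s
    · rw [Set.indicator_of_mem hx]
      exact Finset.prod_congr rfl fun i _ ↦ (Set.indicator_of_mem (hx i trivial) _).symm
    · rw [Set.indicator_of_notMem hx]
      obtain ⟨i, hi⟩ : ∃ i, x i ∉ s i := by simpa [Set.mem_pi] using hx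
      exact (Finset.prod_eq_zero (Finset.mem_univ i) (Set.indicator_of_notMem hi _)).symm
  rw [withDensity_apply _ (MeasurableSet.univ_pi hs), ← lintegral_indicator (.univ_pi hs), hind,
    lintegral_prod_eq_prod_lintegral_of_indepFun Finset.univ
      (fun i (x : ∀ i, α i) ↦ (s i).indicator (f i) (x i))
      (iIndepFun_pi fun i ↦ (hmeas i).aemeasurable)
      fun i ↦ (hmeas i).comp (measurable_pi_apply i)]
  refine Finset.prod_congr rfl fun i _ ↦ ?_
  rw [withDensity_apply _ (hs i), ← lintegral_indicator (hs i)]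
  exact (measurePreserving_eval μ i).lintegral_comp (hmeas i)

/-- The density of `N(a, v)` with respect to `N(b, v)`. -/
noncomputable def gaussianDensityRatio (a b : ℝ) (v : ℝ≥0) (x : ℝ) : ℝ :=
  exp ((a - b) * (x - b) / v - (a - b) ^ 2 / (2 * v))

theorem gaussianDensityRatio_pos (a b : ℝ) (v : ℝ≥0) (x : ℝ) : 0 < gaussianDensityRatio a b v x :=
  exp_pos _

theorem measurable_gaussianDensityRatio (a b : ℝ) (v : ℝ≥0) :
    Measurable (gaussianDensityRatio a b v) := by
  unfold gaussianDensityRatio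
  fun_prop

theorem gaussianReal_withDensity_gaussianDensityRatio (a b : ℝ) {v : ℝ≥0} (hv : v ≠ 0) :
    (gaussianReal b v).withDensity (fun x ↦ ENNReal.ofReal (gaussianDensityRatio a b v x)) =
      gaussianReal a v := by
  have hv' : (v : ℝ) ≠ 0 := by exact_mod_cast hv
  rw [gaussianReal_of_var_ne_zero _ hv, gaussianReal_of_var_ne_zero _ hv,
    ← withDensity_mul _ (measurable_gaussianPDF b v)
      (measurable_gaussianDensityRatio a b v).ennreal_ofReal]
  congr 1
  ext x
  rw [Pi.mul_apply, gaussianPDF, gaussianPDF, ← ENNReal.ofReal_mul (gaussianPDFReal_nonneg _ _ _),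
    gaussianPDFReal, gaussianPDFReal, gaussianDensityRatio, mul_assoc, ← exp_add]
  congr 3
  field_simp
  ring

theorem integral_gaussianDensityRatio_rpow (a b : ℝ) {v : ℝ≥0} (hv : v ≠ 0) (l : ℝ) :
    ∫ x, gaussianDensityRatio a b v x ^ l ∂gaussianReal b v =
      exp ((l - 1) * (l * (a - b) ^ 2 / (2 * v))) := by
  have hv' : (v : ℝ) ≠ 0 := by exact_mod_cast hv
  have h (x : ℝ) : gaussianDensityRatio a b v x ^ l =
      exp (-(l * ((a - b) * b / v + (a - b) ^ 2 / (2 * v)))) * exp (l * (a - b) / v * x) := by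
    rw [gaussianDensityRatio, ← exp_mul, ← exp_add]
    congr 1
    field_simp
    ring
  have hmgf : ∫ x, exp (l * (a - b) / v * x) ∂gaussianReal b v =
      exp (b * (l * (a - b) / v) + v * (l * (a - b) / v) ^ 2 / 2) :=
    mgf_gaussianReal (X := id) Measure.map_id _
  simp_rw [h]
  rw [integral_const_mul, hmgf, ← exp_add]
  congr 1
  field_simp
  ring

/-- The density of a product of Gaussian measures with respect to another one with the same
variances is the product of the density ratios of the factors. -/
theorem rnDeriv_pi_gaussianReal {ι : Type*} [Fintype ι] (a b : ι → ℝ) {v : ℝ≥0} (hv : v ≠ 0) :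
    (Measure.pi fun i ↦ gaussianReal (a i) v).rnDeriv (Measure.pi fun i ↦ gaussianReal (b i) v)
      =ᵐ[Measure.pi fun i ↦ gaussianReal (b i) v]
        fun x ↦ ∏ i, ENNReal.ofReal (gaussianDensityRatio (a i) (b i) v (x i)) := by
  have hmeas (i : ι) :
      Measurable fun x ↦ ENNReal.ofReal (gaussianDensityRatio (a i) (b i) v x) :=
    (measurable_gaussianDensityRatio _ _ _).ennreal_ofReal
  have hpi := pi_withDensity (fun i ↦ gaussianReal (b i) v) hmeas
  simp_rw [gaussianReal_withDensity_gaussianDensityRatio _ _ hv] at hpi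
  rw [hpi]
  exact Measure.rnDeriv_withDensity _
    (Finset.measurable_fun_prod _ fun i _ ↦ (hmeas i).comp (measurable_pi_apply i))

/-- The exponential moment of order `l` of the Rényi divergence between two products of Gaussian
measures with the same variances. -/
theorem integral_rnDeriv_pi_gaussianReal_rpow {ι : Type*} [Fintype ι] (a b : ι → ℝ) {v : ℝ≥0}
    (hv : v ≠ 0) (l : ℝ) :
    ∫ x, ((Measure.pi fun i ↦ gaussianReal (a i) v).rnDeriv
          (Measure.pi fun i ↦ gaussianReal (b i) v) x).toReal ^ l
        ∂(Measure.pi fun i ↦ gaussianReal (b i) v) =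
      exp ((l - 1) * (l * (∑ i, (a i - b i) ^ 2) / (2 * v))) := by
  have h : (fun x ↦ ((Measure.pi fun i ↦ gaussianReal (a i) v).rnDeriv
        (Measure.pi fun i ↦ gaussianReal (b i) v) x).toReal ^ l)
      =ᵐ[Measure.pi fun i ↦ gaussianReal (b i) v]
        fun x ↦ ∏ i, gaussianDensityRatio (a i) (b i) v (x i) ^ l := by
    filter_upwards [rnDeriv_pi_gaussianReal a b hv] with x hx
    rw [hx, ENNReal.toReal_prod, Real.finsetProd_rpow _ _
      fun i _ ↦ (gaussianDensityRatio_pos _ _ _ _).le]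
    simp_rw [ENNReal.toReal_ofReal (gaussianDensityRatio_pos _ _ _ _).le]
  rw [integral_congr_ae h,
    integral_fintype_prod_eq_prod fun i y ↦ gaussianDensityRatio (a i) (b i) v y ^ l]
  simp_rw [integral_gaussianDensityRatio_rpow _ _ hv]
  rw [← exp_sum, ← Finset.mul_sum, ← Finset.sum_div, ← Finset.mul_sum]

/-- Gaussian mechanism (RDP guarantee): if `‖μ - ν‖₂ ≤ S`, then the isotropic Gaussians
`P = N(μ, σ²I)` and `Q = N(ν, σ²I)` on `ℝⁿ` satisfy
`∫ (dP/dQ)^λ dQ ≤ exp ((λ-1) * λ * S² / (2σ²))`, i.e. the mechanism is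
`(λ, λS²/(2σ²))`-RDP. -/
theorem gaussian_mechanism_rdp (σ : ℝ) (hσ : 0 < σ) (n : ℕ) (hn : 0 < n)
    (l : ℝ) (hl : 1 < l) (S : ℝ) (hS : 0 ≤ S)
    (μ ν : EuclideanSpace ℝ (Fin n)) (hsens : ‖μ - ν‖ ≤ S) :
    ∫ x, ((Measure.pi fun i : Fin n => gaussianReal (μ i) ⟨σ ^ 2, sq_nonneg σ⟩).rnDeriv
          (Measure.pi fun i : Fin n => gaussianReal (ν i) ⟨σ ^ 2, sq_nonneg σ⟩) x).toReal
          ^ l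
        ∂(Measure.pi fun i : Fin n => gaussianReal (ν i) ⟨σ ^ 2, sq_nonneg σ⟩) ≤
      Real.exp ((l - 1) * (l * S ^ 2 / (2 * σ ^ 2))) := by
  have hv : (⟨σ ^ 2, sq_nonneg σ⟩ : ℝ≥0) ≠ 0 := fun h ↦
    (pow_pos hσ 2).ne' (congrArg NNReal.toReal h)
  rw [integral_rnDeriv_pi_gaussianReal_rpow (fun i ↦ μ i) (fun i ↦ ν i) hv l, exp_le_exp]
  have hsum : ∑ i, (μ i - ν i) ^ 2 ≤ S ^ 2 := by
    simpa [EuclideanSpace.norm_sq_eq] using pow_le_pow_left₀ (norm_nonneg _) hsens 2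
  have hl₁ : 0 ≤ l - 1 := by linarith
  change (l - 1) * (l * (∑ i, (μ i - ν i) ^ 2) / (2 * σ ^ 2)) ≤ _
  gcongr
end

section
/- Privacy guarantee of DPDFD (non-adaptive instantiation): let n, B, T be positive natural numbers, σ > 0, C ≥ 0, λ > 1, and δ ∈ (0,1). For k = 1, …, B·T let μ_k, ν_k ∈ ℝⁿ with ‖μ_k − ν_k‖₂ ≤ 2C√n, and let P = ⊗_{k=1}^{BT} ⊗_{i=1}^{n} N((μ_k)ᵢ, σ²) and Q = ⊗_{k=1}^{BT} ⊗_{i=1}^{n} N((ν_k)ᵢ, σ²) be the joint output distributions of B·T Gaussian mechanisms with per-step ℓ₂-sensitivity at most 2C√n and noise variance σ². Then for every measurable set O, P(O) ≤ exp( 2C²nBTλ/σ² + log((λ−1)/λ) − (log δ + log λ)/(λ−1) ) · Q(O) + δ; i.e., the composed mechanism guarantees (2C²nBTλ/σ² + log((λ−1)/λ) − (log δ + log λ)/(λ−1), δ)-DP. -/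
open Real ProbabilityTheory MeasureTheory

open scoped ENNReal NNReal

/-- Tangent line bound for `x ↦ x ^ l` at `x = s`. -/
lemma le_add_div_rpow {s l x : ℝ} (hs : 0 < s) (hl : 1 < l) (hx : 0 ≤ x) :
    x ≤ s * ((l - 1) / l) + s / (l * s ^ l) * x ^ l := by
  have hl0 : 0 < l := zero_lt_one.trans hl
  have hsl : 0 < s ^ l := rpow_pos_of_pos hs l
  have h := one_add_mul_self_le_rpow_one_add (s := x / s - 1) (by
    have : 0 ≤ x / s := by positivity
    linarith) hl.le
  rw [add_sub_cancel, div_rpow hx hs.le] at h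
  have h2 := mul_le_mul_of_nonneg_left h (show 0 ≤ s / l by positivity)
  have e1 : s / l * (1 + l * (x / s - 1)) = x - s * ((l - 1) / l) := by field_simp; ring
  have e2 : s / l * (x ^ l / s ^ l) = s / (l * s ^ l) * x ^ l := by field_simp
  linarith

/-- Conversion of a Rényi divergence bound of order `l` into an approximate-DP bound. -/
lemma withDensity_apply_le_of_lintegral_rpow_le {Ω : Type*} [MeasurableSpace Ω] (Q : Measure Ω)
    {w : Ω → ℝ≥0∞} (hw : Measurable w) {l R δ : ℝ} (hl : 1 < l) (hδ : 0 < δ)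
    (h : ∫⁻ x, w x ^ l ∂Q ≤ ENNReal.ofReal (exp ((l - 1) * R)))
    {O : Set Ω} (hO : MeasurableSet O) :
    Q.withDensity w O ≤
      ENNReal.ofReal (exp (R + log ((l - 1) / l) - (log δ + log l) / (l - 1))) * Q O
        + ENNReal.ofReal δ := by
  have hl0 : 0 < l := zero_lt_one.trans hl
  have hl1 : 0 < l - 1 := sub_pos.2 hl
  set s := exp (R - (log δ + log l) / (l - 1)) with hs_def
  have hs : 0 < s := exp_pos _
  have ht : exp (R + log ((l - 1) / l) - (log δ + log l) / (l - 1)) = s * ((l - 1) / l) := by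
    rw [hs_def, ← exp_log (show 0 < (l - 1) / l by positivity), ← exp_add, log_exp]
    congr 1; ring
  have hc : s / (l * s ^ l) = δ * exp (-((l - 1) * R)) := by
    have h1 : s / (l * s ^ l) =
        exp ((R - (log δ + log l) / (l - 1)) - (log l + (R - (log δ + log l) / (l - 1)) * l)) := by
      rw [exp_sub, exp_add, exp_log hl0, exp_mul]
    rw [h1, ← log_injOn_pos.eq_iff (exp_pos _)
      (mul_pos hδ (exp_pos _)), log_exp, log_mul hδ.ne' (exp_ne_zero _), log_exp]
    field_simp
    ring
  rw [ht]
  set c := s / (l * s ^ l) with hc_def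
  have hc0 : 0 < c := by positivity
  have hpt : ∀ x, w x ≤ ENNReal.ofReal (s * ((l - 1) / l)) + ENNReal.ofReal c * w x ^ l := by
    intro x
    by_cases hx : w x = ∞
    · rw [hx, ENNReal.top_rpow_of_pos hl0, ENNReal.mul_top (by simpa using hc0)]
      simp
    · rw [← ENNReal.ofReal_toReal hx, ENNReal.ofReal_rpow_of_nonneg ENNReal.toReal_nonneg hl0.le,
        ← ENNReal.ofReal_mul hc0.le, ← ENNReal.ofReal_add (by positivity) (by positivity)]
      exact ENNReal.ofReal_le_ofReal (le_add_div_rpow hs hl ENNReal.toReal_nonneg)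
  calc Q.withDensity w O = ∫⁻ x in O, w x ∂Q := withDensity_apply _ hO
    _ ≤ ∫⁻ x in O, (ENNReal.ofReal (s * ((l - 1) / l)) + ENNReal.ofReal c * w x ^ l) ∂Q :=
        lintegral_mono hpt
    _ = ENNReal.ofReal (s * ((l - 1) / l)) * Q O
          + ENNReal.ofReal c * ∫⁻ x in O, w x ^ l ∂Q := by
        rw [lintegral_add_left measurable_const, lintegral_const_mul _ (hw.pow_const l)]
        simp
    _ ≤ ENNReal.ofReal (s * ((l - 1) / l)) * Q O
          + ENNReal.ofReal c * ENNReal.ofReal (exp ((l - 1) * R)) := by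
        gcongr
        exact (setLIntegral_le_lintegral _ _).trans h
    _ = _ := by
        rw [← ENNReal.ofReal_mul hc0.le, hc, mul_assoc, ← exp_add]
        simp

section Pi

variable {ι : Type*} [Fintype ι] {X : ι → Type*} [∀ i, MeasurableSpace (X i)]
  (Q : ∀ i, Measure (X i)) [∀ i, IsProbabilityMeasure (Q i)]

lemma lintegral_pi_prod_eq_prod_lintegral {f : ∀ i, X i → ℝ≥0∞} (hf : ∀ i, Measurable (f i)) :
    ∫⁻ x, ∏ i, f i (x i) ∂Measure.pi Q = ∏ i, ∫⁻ x, f i x ∂Q i := by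
  rw [lintegral_prod_eq_prod_lintegral_of_indepFun Finset.univ (fun i (x : ∀ i, X i) ↦ f i (x i))
    (iIndepFun_pi fun i ↦ (hf i).aemeasurable) fun i ↦ (hf i).comp (measurable_pi_apply i)]
  refine Finset.prod_congr rfl fun i _ ↦ ?_
  exact (measurePreserving_eval Q i).lintegral_comp (hf i)

lemma pi_withDensity_eq {f : ∀ i, X i → ℝ≥0∞} (hf : ∀ i, Measurable (f i))
    [∀ i, SigmaFinite ((Q i).withDensity (f i))] :
    Measure.pi (fun i ↦ (Q i).withDensity (f i)) =
      (Measure.pi Q).withDensity fun x ↦ ∏ i, f i (x i) := by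
  refine Measure.pi_eq fun s hs ↦ ?_
  rw [withDensity_apply _ (MeasurableSet.univ_pi hs),
    ← lintegral_indicator (MeasurableSet.univ_pi hs)]
  have hind : ∀ x, (Set.univ.pi s).indicator (fun x ↦ ∏ i, f i (x i)) x =
      ∏ i, (s i).indicator (f i) (x i) := by
    intro x
    classical
    by_cases hx : x ∈ Set.univ.pi s
    · rw [Set.indicator_of_mem hx]
      exact Finset.prod_congr rfl fun i _ ↦ (Set.indicator_of_mem (hx i trivial) _).symm
    · rw [Set.indicator_of_notMem hx]
      simp only [Set.mem_pi, Set.mem_univ, true_imp_iff, not_forall] at hx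
      obtain ⟨i, hi⟩ := hx
      exact (Finset.prod_eq_zero (Finset.mem_univ i) (Set.indicator_of_notMem hi _)).symm
  simp_rw [hind]
  rw [lintegral_pi_prod_eq_prod_lintegral Q fun i ↦ (hf i).indicator (hs i)]
  refine Finset.prod_congr rfl fun i _ ↦ ?_
  rw [lintegral_indicator (hs i), withDensity_apply _ (hs i)]

end Pi

/-- The likelihood ratio of `gaussianReal a v` with respect to `gaussianReal b v`. -/
noncomputable def gaussianRatio (a b : ℝ) (v : ℝ≥0) (x : ℝ) : ℝ≥0∞ :=
  ENNReal.ofReal (exp ((a - b) / v * x - (a ^ 2 - b ^ 2) / (2 * v)))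

@[fun_prop]
lemma measurable_gaussianRatio (a b : ℝ) (v : ℝ≥0) : Measurable (gaussianRatio a b v) := by
  unfold gaussianRatio
  fun_prop

lemma gaussianReal_withDensity_gaussianRatio (a b : ℝ) {v : ℝ≥0} (hv : v ≠ 0) :
    (gaussianReal b v).withDensity (gaussianRatio a b v) = gaussianReal a v := by
  rw [gaussianReal_of_var_ne_zero a hv, gaussianReal_of_var_ne_zero b hv,
    ← withDensity_mul _ (measurable_gaussianPDF b v) (measurable_gaussianRatio a b v)]
  congr 1
  ext1 x
  have hv' : (v : ℝ) ≠ 0 := by exact_mod_cast hv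
  rw [Pi.mul_apply, gaussianPDF, gaussianPDF, gaussianRatio,
    ← ENNReal.ofReal_mul (gaussianPDFReal_nonneg b v x), gaussianPDFReal, gaussianPDFReal,
    mul_assoc, ← exp_add]
  congr 3
  field_simp
  ring

lemma lintegral_gaussianRatio_rpow (a b : ℝ) {v : ℝ≥0} (hv : v ≠ 0) {l : ℝ} (hl : 0 ≤ l) :
    ∫⁻ x, gaussianRatio a b v x ^ l ∂gaussianReal b v =
      ENNReal.ofReal (exp (l * (l - 1) * (a - b) ^ 2 / (2 * v))) := by
  have hv' : (v : ℝ) ≠ 0 := by exact_mod_cast hv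
  have hint := integrable_exp_mul_gaussianReal (μ := b) (v := v) (l * (a - b) / v)
  have hmgf := congrFun (mgf_fun_id_gaussianReal (μ := b) (v := v)) (l * (a - b) / v)
  rw [mgf] at hmgf
  have hrw : ∀ x, gaussianRatio a b v x ^ l = ENNReal.ofReal
      (exp (-(l * (a ^ 2 - b ^ 2) / (2 * v))) * exp (l * (a - b) / v * x)) := by
    intro x
    rw [gaussianRatio, ENNReal.ofReal_rpow_of_nonneg (exp_pos _).le hl, ← exp_mul, ← exp_add]
    congr 2
    ring
  simp_rw [hrw]
  rw [← ofReal_integral_eq_lintegral_ofReal (hint.const_mul _)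
    (Filter.Eventually.of_forall fun x ↦ by positivity), integral_const_mul, hmgf, ← exp_add]
  congr 2
  field_simp
  ring

section GaussianPi

variable {κ ι : Type*} [Fintype κ] [Fintype ι]

lemma pi_pi_gaussianReal_eq_withDensity (a b : κ → ι → ℝ) {v : ℝ≥0} (hv : v ≠ 0) :
    (Measure.pi fun k ↦ Measure.pi fun i ↦ gaussianReal (a k i) v) =
      (Measure.pi fun k ↦ Measure.pi fun i ↦ gaussianReal (b k i) v).withDensity
        fun x ↦ ∏ k, ∏ i, gaussianRatio (a k i) (b k i) v (x k i) := by
  have hone : ∀ a b : ℝ, IsProbabilityMeasure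
      ((gaussianReal b v).withDensity (gaussianRatio a b v)) := fun a b ↦ by
    rw [gaussianReal_withDensity_gaussianRatio a b hv]; infer_instance
  have hinner : ∀ k, (Measure.pi fun i ↦ gaussianReal (b k i) v).withDensity
      (fun x ↦ ∏ i, gaussianRatio (a k i) (b k i) v (x i)) =
        Measure.pi fun i ↦ gaussianReal (a k i) v := fun k ↦ by
    rw [← pi_withDensity_eq _ fun i ↦ measurable_gaussianRatio (a k i) (b k i) v]
    simp_rw [gaussianReal_withDensity_gaussianRatio _ _ hv]
  have : ∀ k, SigmaFinite ((Measure.pi fun i ↦ gaussianReal (b k i) v).withDensity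
      fun x ↦ ∏ i, gaussianRatio (a k i) (b k i) v (x i)) := fun k ↦ by
    rw [hinner]; infer_instance
  rw [← pi_withDensity_eq (fun k ↦ Measure.pi fun i ↦ gaussianReal (b k i) v)
    (f := fun k x ↦ ∏ i, gaussianRatio (a k i) (b k i) v (x i)) fun k ↦ by fun_prop]
  simp_rw [hinner]

lemma lintegral_pi_pi_gaussianRatio_rpow (a b : κ → ι → ℝ) {v : ℝ≥0} (hv : v ≠ 0)
    {l : ℝ} (hl : 0 ≤ l) :
    ∫⁻ x, (∏ k, ∏ i, gaussianRatio (a k i) (b k i) v (x k i)) ^ l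
        ∂(Measure.pi fun k ↦ Measure.pi fun i ↦ gaussianReal (b k i) v) =
      ENNReal.ofReal (exp (∑ k, l * (l - 1) * (∑ i, (a k i - b k i) ^ 2) / (2 * v))) := by
  simp_rw [← ENNReal.prod_rpow_of_nonneg hl]
  rw [lintegral_pi_prod_eq_prod_lintegral (fun k ↦ Measure.pi fun i ↦ gaussianReal (b k i) v)
    (f := fun k x ↦ ∏ i, gaussianRatio (a k i) (b k i) v (x i) ^ l) fun k ↦ by fun_prop]
  rw [exp_sum, ENNReal.ofReal_prod_of_nonneg fun _ _ ↦ (exp_pos _).le]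
  refine Finset.prod_congr rfl fun k _ ↦ ?_
  rw [lintegral_pi_prod_eq_prod_lintegral (fun i ↦ gaussianReal (b k i) v)
    (f := fun i x ↦ gaussianRatio (a k i) (b k i) v x ^ l) fun i ↦ by fun_prop]
  simp_rw [lintegral_gaussianRatio_rpow _ _ hv hl]
  rw [← ENNReal.ofReal_prod_of_nonneg fun _ _ ↦ (exp_pos _).le, ← exp_sum, Finset.mul_sum,
    Finset.sum_div]

end GaussianPi

/-- Privacy guarantee of DPDFD (non-adaptive instantiation): the composition of `B·T`
Gaussian mechanisms with per-step ℓ₂-sensitivity at most `2C√n` and noise variance `σ²`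
guarantees `(2C²nBTλ/σ² + log ((λ-1)/λ) - (log δ + log λ)/(λ-1), δ)`-DP. -/
theorem dpdfd_privacy_guarantee (n B T : ℕ) (hn : 0 < n) (hB : 0 < B) (hT : 0 < T)
    (σ : ℝ) (hσ : 0 < σ) (C : ℝ) (hC : 0 ≤ C) (l : ℝ) (hl : 1 < l)
    (δ : ℝ) (hδ : δ ∈ Set.Ioo (0 : ℝ) 1)
    (μ ν : Fin (B * T) → EuclideanSpace ℝ (Fin n))
    (hsens : ∀ k, ‖μ k - ν k‖ ≤ 2 * C * Real.sqrt n) :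
    ∀ O : Set (Fin (B * T) → Fin n → ℝ), MeasurableSet O →
      ((Measure.pi fun k : Fin (B * T) =>
          Measure.pi fun i : Fin n => gaussianReal (μ k i) ⟨σ ^ 2, sq_nonneg σ⟩) O).toReal ≤
        Real.exp (2 * C ^ 2 * n * B * T * l / σ ^ 2 + Real.log ((l - 1) / l) -
            (Real.log δ + Real.log l) / (l - 1)) *
          ((Measure.pi fun k : Fin (B * T) =>
            Measure.pi fun i : Fin n => gaussianReal (ν k i) ⟨σ ^ 2, sq_nonneg σ⟩) O).toReal
        + δ := by
  intro O hO
  have hl0 : 0 < l := zero_lt_one.trans hl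
  have hl1 : 0 < l - 1 := sub_pos.2 hl
  obtain ⟨v, hv_def⟩ : ∃ v : ℝ≥0, v = ⟨σ ^ 2, sq_nonneg σ⟩ := ⟨_, rfl⟩
  have hvσ : (v : ℝ) = σ ^ 2 := congrArg NNReal.toReal hv_def
  have hv : v ≠ 0 := by
    rintro rfl
    exact (pow_pos hσ 2).ne hvσ
  rw [← hv_def]
  have hsq : ∀ k, ∑ i, (μ k i - ν k i) ^ 2 ≤ 4 * C ^ 2 * n := by
    intro k
    have h := pow_le_pow_left₀ (norm_nonneg _) (hsens k) 2
    rw [EuclideanSpace.real_norm_sq_eq, mul_pow, Real.sq_sqrt n.cast_nonneg] at h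
    simp only [PiLp.sub_apply] at h
    linarith
  have hmoment := lintegral_pi_pi_gaussianRatio_rpow (fun k i ↦ μ k i) (fun k i ↦ ν k i) hv hl0.le
  have hbound : ∑ k, l * (l - 1) * (∑ i, (μ k i - ν k i) ^ 2) / (2 * v) ≤
      (l - 1) * (2 * C ^ 2 * n * B * T * l / σ ^ 2) := by
    calc ∑ k, l * (l - 1) * (∑ i, (μ k i - ν k i) ^ 2) / (2 * v)
        ≤ ∑ _k : Fin (B * T), l * (l - 1) * (4 * C ^ 2 * n) / (2 * v) := by
          gcongr with k
          exact hsq k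
      _ = _ := by
          rw [Finset.sum_const, Finset.card_univ, Fintype.card_fin, nsmul_eq_mul, hvσ]
          push_cast
          field_simp
          ring
  have key := withDensity_apply_le_of_lintegral_rpow_le
    (Measure.pi fun k ↦ Measure.pi fun i ↦ gaussianReal (ν k i) v) (by fun_prop) hl hδ.1
    (hmoment.le.trans (ENNReal.ofReal_le_ofReal (exp_le_exp.2 hbound))) hO
  rw [← pi_pi_gaussianReal_eq_withDensity _ _ hv] at key
  have h := ENNReal.toReal_mono (by finiteness) key
  rwa [ENNReal.toReal_add (by finiteness) (by finiteness), ENNReal.toReal_mul,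
    ENNReal.toReal_ofReal (exp_pos _).le, ENNReal.toReal_ofReal hδ.1.le] at h
end
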